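/- arXiv:1903.05272 — 4 statements merged into one kernel-verified Lean document; each statement's English description precedes it below -/
import Mathlib

section
/- Let Γ be the n×n matrix over R with entries Γ_{ij} = (T^i v)^t · C · (T^j v) for i, j = 0,1,…,n−1, where C = diag(x_1,…,x_n). Then there exists a nonzero constant c ∈ ℂ such that det Γ = c · (∏_{1≤i<j≤n} (x_i + x_j))^2 · x_1 x_2 ⋯ x_n. -/
open MvPolynomial Matrix

noncomputable section

/-- The matrix `T` over `ℂ[x₁,…,xₙ]` with `T i j = x j` for `i < j`, `-x j` for `i > j`,
and `0` on the diagonal. -/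
def Tmat (n : ℕ) : Matrix (Fin n) (Fin n) (MvPolynomial (Fin n) ℂ) :=
  Matrix.of fun i j => if i < j then X j else if j < i then -X j else 0

/-- The Gram matrix `Γ` with `Γ i j = (Tⁱ v)ᵗ · C · (Tʲ v)`, where `v` is the all-ones
vector and `C = diag (x₁,…,xₙ)`. -/
def Gram (n : ℕ) : Matrix (Fin n) (Fin n) (MvPolynomial (Fin n) ℂ) :=
  Matrix.of fun i j =>
    dotProduct ((Tmat n ^ (i : ℕ)).mulVec (fun _ => 1))
      ((Matrix.diagonal fun i : Fin n => (X i : MvPolynomial (Fin n) ℂ)).mulVec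
        ((Tmat n ^ (j : ℕ)).mulVec (fun _ => 1)))

open Finset in
theorem sum_range_sign_mul_sub {M : Type*} [AddCommGroup M] (A : ℕ → M) (i N : ℕ) :
    ∑ t ∈ range N, (if i < t then A t - A (t + 1) else if t < i then -(A t - A (t + 1)) else 0) =
      if N ≤ i then A N - A 0 else A (i + 1) - A N - A 0 + A i := by
  induction N with
  | zero => simp
  | succ N ih =>
    rw [sum_range_succ, ih]
    rcases lt_trichotomy N i with h | rfl | h
    · rw [if_pos h.le, if_neg h.not_gt, if_pos h, if_pos (Nat.succ_le_of_lt h)]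
      abel
    · simp
      abel
    · rw [if_neg (by lia), if_pos h, if_neg (by lia)]
      abel

section SignedMatrix

variable {R : Type*} [CommRing R] {n : ℕ} (x : Fin n → R)

/-- The matrix with entries `x j` above the diagonal, `-x j` below it and `0` on it. -/
def signedMatrix : Matrix (Fin n) (Fin n) R :=
  Matrix.of fun i j => if i < j then x j else if j < i then -x j else 0

/-- The Krylov matrix of `signedMatrix x` and the all-ones vector. -/
def krylovMatrix : Matrix (Fin n) (Fin n) R :=
  Matrix.of fun i k => ((signedMatrix x ^ (k : ℕ)) *ᵥ fun _ => 1) i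

/-- The product of `Y - x j` over `j < t` and `Y + x j` over `t ≤ j`. -/
def signedProd (t : ℕ) : Polynomial R :=
  ∏ j : Fin n, (Polynomial.X + Polynomial.C (if (j : ℕ) < t then -x j else x j))

/-- The product of `Y - x j` over `j < i` and `Y + x j` over `i < j`. -/
def signedProdErase (i : Fin n) : Polynomial R :=
  ∏ j ∈ Finset.univ.erase i, (Polynomial.X + Polynomial.C (if j < i then -x j else x j))

theorem signedProd_self (i : Fin n) :
    signedProd x i = (Polynomial.X + Polynomial.C (x i)) * signedProdErase x i := by
  rw [signedProd, ← Finset.mul_prod_erase _ _ (Finset.mem_univ i)]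
  simp [signedProdErase]

theorem signedProd_succ (i : Fin n) :
    signedProd x (i + 1) = (Polynomial.X - Polynomial.C (x i)) * signedProdErase x i := by
  rw [signedProd, ← Finset.mul_prod_erase _ _ (Finset.mem_univ i), signedProdErase]
  congr 1
  · simp [sub_eq_add_neg]
  · refine Finset.prod_congr rfl fun j hj => ?_
    have hji : (j : ℕ) ≠ i := fun h => Finset.ne_of_mem_erase hj (Fin.ext h)
    have : (j : ℕ) < i + 1 ↔ j < i := by rw [Fin.lt_def]; lia
    simp only [this]

theorem monic_signedProd (t : ℕ) : (signedProd x t).Monic :=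
  Polynomial.monic_prod_of_monic _ _ fun _ _ => Polynomial.monic_X_add_C _

theorem natDegree_signedProd [Nontrivial R] (t : ℕ) : (signedProd x t).natDegree = n := by
  rw [signedProd, Polynomial.natDegree_prod_of_monic _ _ fun _ _ => Polynomial.monic_X_add_C _]
  simp

theorem natDegree_signedProdErase_lt [Nontrivial R] (i : Fin n) :
    (signedProdErase x i).natDegree < n := by
  rw [signedProdErase,
    Polynomial.natDegree_prod_of_monic _ _ fun _ _ => Polynomial.monic_X_add_C _]
  have := i.isLt
  simp
  lia

theorem two_mul_resolvent_signedProdErase (i : Fin n) :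
    2 * (Polynomial.X * signedProdErase x i -
      ∑ j, Polynomial.C (signedMatrix x i j) * signedProdErase x j) =
      signedProd x 0 + signedProd x n := by
  have hsum : ∑ j, 2 * (Polynomial.C (signedMatrix x i j) * signedProdErase x j) =
      signedProd x (i + 1) - signedProd x n - signedProd x 0 + signedProd x i := by
    have h := sum_range_sign_mul_sub (signedProd x) i n
    rw [if_neg (by lia), ← Fin.sum_univ_eq_sum_range] at h
    rw [← h]
    refine Finset.sum_congr rfl fun j _ => ?_
    rw [signedProd_self, signedProd_succ]
    simp only [signedMatrix, Matrix.of_apply, Fin.lt_def]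
    split_ifs
    · ring
    · rw [Polynomial.C_neg]
      ring
    · simp
  rw [mul_sub, Finset.mul_sum, hsum, signedProd_self, signedProd_succ]
  ring

theorem coeff_signedProdErase_mul_vandermonde [Nontrivial R] :
    (Matrix.of fun i m : Fin n => (signedProdErase x i).coeff m) * (Matrix.vandermonde x)ᵀ =
      Matrix.of fun i l => (signedProdErase x i).eval (x l) := by
  ext i l
  rw [Matrix.of_apply, Polynomial.eval_eq_sum_range' (natDegree_signedProdErase_lt x i),
    ← Fin.sum_univ_eq_sum_range (fun m => (signedProdErase x i).coeff m * x l ^ m)]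
  simp [Matrix.mul_apply, Matrix.vandermonde_apply]

theorem eval_signedProdErase (i l : Fin n) :
    (signedProdErase x i).eval (x l) =
      (∏ j ∈ Finset.Iio i, (x l - x j)) * ∏ j ∈ Finset.Ioi i, (x l + x j) := by
  have hs : Finset.univ.erase i = Finset.Iio i ∪ Finset.Ioi i := by
    ext j
    simp [lt_or_lt_iff_ne]
  have hd : Disjoint (Finset.Iio i) (Finset.Ioi i) :=
    Finset.disjoint_left.2 fun j hj hj' => lt_asymm (Finset.mem_Iio.1 hj) (Finset.mem_Ioi.1 hj')
  rw [signedProdErase, hs, Finset.prod_union hd, Polynomial.eval_mul, Polynomial.eval_prod,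
    Polynomial.eval_prod]
  congr 1
  · refine Finset.prod_congr rfl fun j hj => ?_
    simp [Finset.mem_Iio.1 hj, sub_eq_add_neg]
  · refine Finset.prod_congr rfl fun j hj => ?_
    simp [(Finset.mem_Ioi.1 hj).not_gt]

theorem det_eval_signedProdErase :
    (Matrix.of fun i l => (signedProdErase x i).eval (x l)).det =
      (∏ i, ∏ j ∈ Finset.Ioi i, (x i + x j)) * (Matrix.vandermonde x).det := by
  rw [Matrix.det_of_isUpperTriangular, Matrix.det_vandermonde]
  · simp only [Matrix.of_apply, eval_signedProdErase, Finset.prod_mul_distrib]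
    rw [mul_comm]
    congr 1
    exact Finset.prod_comm' (by simp)
  · intro i l hil
    have hil : l < i := hil
    rw [Matrix.of_apply, eval_signedProdErase,
      Finset.prod_eq_zero (Finset.mem_Iio.2 hil) (sub_self _), zero_mul]

section Half

variable [Invertible (2 : R)]

/-- The average of `∏ (Y + x j)` and `∏ (Y - x j)`. -/
def signedMean : Polynomial R :=
  Polynomial.C (⅟2) * (signedProd x 0 + signedProd x n)

theorem resolvent_signedProdErase (i : Fin n) :
    Polynomial.X * signedProdErase x i -
      ∑ j, Polynomial.C (signedMatrix x i j) * signedProdErase x j = signedMean x := by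
  rw [signedMean, ← two_mul_resolvent_signedProdErase x i, ← mul_assoc,
    show (2 : Polynomial R) = Polynomial.C 2 from rfl, ← Polynomial.C_mul, invOf_mul_self,
    Polynomial.C_1, one_mul]

theorem coeff_signedMean_self [Nontrivial R] : (signedMean x).coeff n = 1 := by
  have h (t : ℕ) : (signedProd x t).coeff n = 1 := by
    simpa [natDegree_signedProd] using (monic_signedProd x t).coeff_natDegree
  rw [signedMean, Polynomial.coeff_C_mul, Polynomial.coeff_add, h, h, one_add_one_eq_two,
    invOf_mul_self]

theorem coeff_signedMean_of_lt [Nontrivial R] {m : ℕ} (hm : n < m) :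
    (signedMean x).coeff m = 0 := by
  have h (t : ℕ) : (signedProd x t).coeff m = 0 :=
    Polynomial.coeff_eq_zero_of_natDegree_lt (by rwa [natDegree_signedProd])
  rw [signedMean, Polynomial.coeff_C_mul, Polynomial.coeff_add, h, h, add_zero, mul_zero]

theorem coeff_signedProdErase_eq_mulVec (m : ℕ) :
    (fun i => (signedProdErase x i).coeff m) =
      (signedMean x).coeff (m + 1) • (fun _ => 1) +
        signedMatrix x *ᵥ fun i => (signedProdErase x i).coeff (m + 1) := by
  ext i
  rw [← resolvent_signedProdErase x i]
  simp [Matrix.mulVec, dotProduct, Polynomial.finsetSum_coeff]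

theorem coeff_signedProdErase_expand (m N : ℕ) :
    (fun i => (signedProdErase x i).coeff m) =
      ∑ k ∈ Finset.range N,
        (signedMean x).coeff (k + m + 1) • (signedMatrix x ^ k *ᵥ fun _ => 1) +
      signedMatrix x ^ N *ᵥ fun i => (signedProdErase x i).coeff (N + m) := by
  induction N with
  | zero => simp
  | succ N ih =>
    rw [ih, coeff_signedProdErase_eq_mulVec x (N + m), Finset.sum_range_succ, Matrix.mulVec_add,
      Matrix.mulVec_smul, Matrix.mulVec_mulVec, ← pow_succ, ← add_assoc,
      add_right_comm N 1 m]

/-- The Hankel matrix of the coefficients of `signedMean x`. -/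
def hankelMean : Matrix (Fin n) (Fin n) R :=
  Matrix.of fun k m => (signedMean x).coeff (k + m + 1)

theorem krylovMatrix_mul_hankelMean [Nontrivial R] :
    krylovMatrix x * hankelMean x =
      Matrix.of fun i m : Fin n => (signedProdErase x i).coeff m := by
  ext i m
  have h := congrFun (coeff_signedProdErase_expand x m n) i
  have h0 : (fun i => (signedProdErase x i).coeff (n + m)) = 0 := by
    ext j
    have := natDegree_signedProdErase_lt x j
    exact Polynomial.coeff_eq_zero_of_natDegree_lt (by lia)
  rw [h0, Matrix.mulVec_zero, add_zero, ← Fin.sum_univ_eq_sum_range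
    (fun k => (signedMean x).coeff (k + m + 1) • (signedMatrix x ^ k *ᵥ fun _ => 1))] at h
  rw [Matrix.of_apply, h, Matrix.mul_apply, Finset.sum_apply]
  exact Finset.sum_congr rfl fun k _ => mul_comm _ _

theorem det_hankelMean_sq [Nontrivial R] : (hankelMean x).det ^ 2 = 1 := by
  have hU : ((hankelMean x).submatrix id Fin.revPerm).det = 1 := by
    rw [Matrix.det_of_isUpperTriangular]
    · refine Finset.prod_eq_one fun i _ => ?_
      rw [← coeff_signedMean_self x]
      simp only [hankelMean, Matrix.submatrix_apply, Matrix.of_apply, id, Fin.revPerm_apply,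
        Fin.val_rev]
      congr 1
      lia
    · intro i j hij
      have hij : (j : ℕ) < i := hij
      refine coeff_signedMean_of_lt x ?_
      simp only [id, Fin.revPerm_apply, Fin.val_rev]
      lia
  rw [Matrix.det_permute'] at hU
  have h := congrArg (· ^ 2) hU
  simpa [mul_pow, ← Int.cast_pow, ← Units.val_pow_eq_pow_val] using h

theorem det_krylovMatrix_sq [IsDomain R] (hx : Function.Injective x) :
    (krylovMatrix x).det ^ 2 = (∏ i, ∏ j ∈ Finset.Ioi i, (x i + x j)) ^ 2 := by
  have h := congrArg Matrix.det (coeff_signedProdErase_mul_vandermonde x)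
  rw [← krylovMatrix_mul_hankelMean, Matrix.det_mul, Matrix.det_mul, Matrix.det_transpose,
    det_eval_signedProdErase] at h
  rw [← mul_right_cancel₀ (Matrix.det_vandermonde_ne_zero_iff.2 hx) h, mul_pow,
    det_hankelMean_sq, mul_one]

end Half

end SignedMatrix

theorem Gram_eq_krylovMatrix (n : ℕ) :
    Gram n = (krylovMatrix (X : Fin n → MvPolynomial (Fin n) ℂ))ᵀ *
      (Matrix.diagonal X * krylovMatrix X) := by
  ext1 i j
  rw [Matrix.mul_apply]
  simp only [Gram, Matrix.of_apply, dotProduct, Matrix.mulVec_diagonal, Matrix.diagonal_mul,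
    Matrix.transpose_apply]
  rfl

theorem det_Gram (n : ℕ) (hn : 0 < n) :
    ∃ c : ℂ, c ≠ 0 ∧
      (Gram n).det = MvPolynomial.C c *
        (∏ p ∈ Finset.univ.filter (fun p : Fin n × Fin n => p.1 < p.2), (X p.1 + X p.2)) ^ 2 *
        ∏ i : Fin n, X i := by
  let _ : Invertible (2 : MvPolynomial (Fin n) ℂ) :=
    (Invertible.map (MvPolynomial.C : ℂ →+* MvPolynomial (Fin n) ℂ) 2).copy _ (map_ofNat _ 2).symm
  refine ⟨1, one_ne_zero, ?_⟩
  have hprod : ∏ p ∈ Finset.univ.filter (fun p : Fin n × Fin n => p.1 < p.2),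
      (X p.1 + X p.2 : MvPolynomial (Fin n) ℂ) = ∏ i, ∏ j ∈ Finset.Ioi i, (X i + X j) :=
    Finset.prod_finset_product _ _ _ (by simp)
  rw [hprod, ← det_krylovMatrix_sq _ (MvPolynomial.X_injective), Gram_eq_krylovMatrix,
    Matrix.det_mul, Matrix.det_mul, Matrix.det_transpose, Matrix.det_diagonal, map_one]
  ring
end
end

section
/- For every k with 2k ≥ n, one has ζ_{2k} = −Σ_{i=1}^{⌊n/2⌋} σ_{2i} · ζ_{2k−2i}, where σ_{2i} is the 2i-th elementary symmetric polynomial in x_1,…,x_n. -/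
open MvPolynomial Matrix

noncomputable section

/-- The polynomial `ζ_m = vᵗ · C · T^m · v`, where `v` is the all-ones vector and
`C = diag (x₁,…,xₙ)`. -/
def zeta (n m : ℕ) : MvPolynomial (Fin n) ℂ :=
  dotProduct (fun _ => 1)
    ((Matrix.diagonal fun i : Fin n => (X i : MvPolynomial (Fin n) ℂ)).mulVec
      ((Tmat n ^ m).mulVec (fun _ => 1)))

/-- Perturbing a matrix by a rank-one matrix changes its determinant by an odd function of the
perturbation. -/
theorem det_add_vecMulVec_add_det_sub_vecMulVec {m R : Type*} [Fintype m] [DecidableEq m]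
    [CommRing R] (A : Matrix m m R) (u w : m → R) :
    (A + vecMulVec u w).det + (A - vecMulVec u w).det = 2 * A.det := by
  have bordered (w : m → R) (c : R) :
      (fromBlocks A (replicateCol Unit u) 0 0).updateRow (Sum.inr ()) (Sum.elim w fun _ => c) =
        fromBlocks A (replicateCol Unit u) (replicateRow Unit w) (Matrix.of fun _ _ => c) := by
    ext (i | i) (j | j) <;> simp [updateRow_apply]
  have one_eq : (Matrix.of fun _ _ : Unit => (1 : R)) = 1 := by
    ext i j; simp
  have det_bordered (w : m → R) :
      ((fromBlocks A (replicateCol Unit u) 0 0).updateRow (Sum.inr ())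
        (Sum.elim w fun _ => (1 : R))).det = (A - vecMulVec u w).det := by
    rw [bordered, one_eq, det_fromBlocks_one₂₂, vecMulVec_eq Unit]
  have hadd : A + vecMulVec u w = A - vecMulVec u (-w) := by
    ext i j; simp [vecMulVec_apply]
  rw [hadd, ← det_bordered, ← det_bordered, ← det_updateRow_add]
  have hrow : (Sum.elim (-w) fun _ : Unit => (1 : R)) + (Sum.elim w fun _ => (1 : R)) =
      Sum.elim (0 : m → R) fun _ => (2 : R) := by
    ext (i | i)
    · simp
    · simp [one_add_one_eq_two]
  have hzero : replicateRow Unit (0 : m → R) = 0 := by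
    ext; simp
  rw [hrow, bordered, hzero, det_fromBlocks_zero₂₁]
  simp [mul_comm]

theorem two_mul_charpoly_Tmat (n : ℕ) :
    2 * (Tmat n).charpoly =
      ∏ i, (Polynomial.X + Polynomial.C (X i)) + ∏ i, (Polynomial.X - Polynomial.C (X i)) := by
  rw [charpoly, ← det_add_vecMulVec_add_det_sub_vecMulVec (charmatrix (Tmat n))
    (fun _ => 1) (fun j => Polynomial.C (X j))]
  congr 1
  · rw [det_of_isLowerTriangular]
    · simp [Tmat, vecMulVec_apply]
    · intro i j hij
      have hij : i < j := hij
      simp [Tmat, vecMulVec_apply, hij, hij.ne]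
  · rw [det_of_isUpperTriangular]
    · simp [Tmat, vecMulVec_apply]
    · intro i j hij
      have hij : j < i := hij
      simp [Tmat, vecMulVec_apply, hij, hij.ne', hij.not_gt]

theorem prod_X_sub_C_X_eq_sum_esymm (σ R : Type*) [Fintype σ] [CommRing R] :
    ∏ i : σ, (Polynomial.X - Polynomial.C (X i : MvPolynomial σ R)) =
      ∑ j ∈ Finset.range (Fintype.card σ + 1),
        (-1) ^ j * (Polynomial.C (esymm σ R j) * Polynomial.X ^ (Fintype.card σ - j)) := by
  have h := Multiset.prod_X_sub_X_eq_sum_esymm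
    (Finset.univ.val.map fun i : σ => (X i : MvPolynomial σ R))
  simpa [Multiset.map_map, Function.comp_def, ← esymm_eq_multiset_esymm] using h

theorem sum_range_one_add_neg_one_pow_mul {R : Type*} [CommRing R] (n : ℕ) (f : ℕ → R) :
    ∑ j ∈ Finset.range (n + 1), (1 + (-1) ^ j) * f j =
      2 * ∑ i ∈ Finset.range (n / 2 + 1), f (2 * i) := by
  induction n with
  | zero => simp [one_add_one_eq_two]
  | succ n ih =>
    rw [Finset.sum_range_succ, ih]
    rcases Nat.even_or_odd' n with ⟨m, rfl | rfl⟩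
    · rw [show (2 * m + 1) / 2 = m by omega, show 2 * m / 2 = m by omega]
      simp [pow_succ]
    · rw [show (2 * m + 1 + 1) / 2 = m + 1 by omega, show (2 * m + 1) / 2 = m by omega,
        Finset.sum_range_succ _ (m + 1), show 2 * m + 1 + 1 = 2 * (m + 1) by ring]
      simp [pow_mul]
      ring

theorem sum_esymm_smul_Tmat_pow (n : ℕ) :
    ∑ j ∈ Finset.range (n + 1), ((1 + (-1) ^ j) * esymm (Fin n) ℂ j) • Tmat n ^ (n - j) = 0 := by
  have h := congrArg (Polynomial.aeval (Tmat n)) (two_mul_charpoly_Tmat n)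
  rw [map_mul, aeval_self_charpoly, mul_zero, MvPolynomial.prod_C_add_X_eq_sum_esymm,
    prod_X_sub_C_X_eq_sum_esymm, ← Finset.sum_add_distrib, map_sum] at h
  rw [h, Fintype.card_fin]
  refine Finset.sum_congr rfl fun j _ => ?_
  have hC : Polynomial.C (esymm (Fin n) ℂ j) * Polynomial.X ^ (n - j) +
      (-1) ^ j * (Polynomial.C (esymm (Fin n) ℂ j) * Polynomial.X ^ (n - j)) =
      Polynomial.C ((1 + (-1) ^ j) * esymm (Fin n) ℂ j) * Polynomial.X ^ (n - j) := by
    simp only [map_mul, map_add, map_pow, map_neg, map_one]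
    ring
  rw [hC, map_mul, map_pow, Polynomial.aeval_C, Polynomial.aeval_X, Algebra.smul_def]

/-- The linear functional `M ↦ vᵗ · C · M · v`. -/
def weightedEntrySum (n : ℕ) :
    Matrix (Fin n) (Fin n) (MvPolynomial (Fin n) ℂ) →ₗ[MvPolynomial (Fin n) ℂ]
      MvPolynomial (Fin n) ℂ where
  toFun M := dotProduct (fun _ => 1)
    ((Matrix.diagonal fun i : Fin n => (X i : MvPolynomial (Fin n) ℂ)).mulVec
      (M.mulVec (fun _ => 1)))
  map_add' M N := by simp only [add_mulVec, mulVec_add, dotProduct_add]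
  map_smul' c M := by simp only [smul_mulVec, mulVec_smul, dotProduct_smul, RingHom.id_apply]

theorem weightedEntrySum_Tmat_pow (n m : ℕ) : weightedEntrySum n (Tmat n ^ m) = zeta n m := rfl

theorem zeta_recursion (n : ℕ) (hn : 0 < n) (k : ℕ) (hk : n ≤ 2 * k) :
    zeta n (2 * k) =
      -∑ i ∈ Finset.Icc 1 (n / 2), esymm (Fin n) ℂ (2 * i) * zeta n (2 * k - 2 * i) := by
  have h := congrArg (fun M => weightedEntrySum n (M * Tmat n ^ (2 * k - n)))
    (sum_esymm_smul_Tmat_pow n)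
  simp only [Finset.sum_mul, smul_mul_assoc, ← pow_add, zero_mul, map_zero, map_sum, map_smul,
    weightedEntrySum_Tmat_pow, smul_eq_mul] at h
  have hexp : ∀ j ∈ Finset.range (n + 1),
      (1 + (-1) ^ j) * esymm (Fin n) ℂ j * zeta n (n - j + (2 * k - n)) =
        (1 + (-1) ^ j) * (esymm (Fin n) ℂ j * zeta n (2 * k - j)) := by
    intro j hj
    have hj := Finset.mem_range.mp hj
    rw [mul_assoc, show n - j + (2 * k - n) = 2 * k - j by omega]
  rw [Finset.sum_congr rfl hexp, sum_range_one_add_neg_one_pow_mul n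
    (fun j => esymm (Fin n) ℂ j * zeta n (2 * k - j))] at h
  have h := (mul_eq_zero.mp h).resolve_left two_ne_zero
  rw [Finset.range_eq_Ico, Finset.sum_eq_sum_Ico_succ_bot (Nat.succ_pos _)] at h
  simp only [mul_zero, esymm_zero, one_mul, Nat.sub_zero, zero_add] at h
  rw [← Finset.Ico_add_one_right_eq_Icc]
  exact eq_neg_of_add_eq_zero_left h
end
end

section
/- For every k ≥ 0, the polynomial ζ_{2k} belongs to the ℂ-subalgebra of R generated by the odd power sums p_1, p_3, p_5, …, where p_m = x_1^m + ⋯ + x_n^m. (That is, each z_{2k} is a Q-symmetric polynomial; for example z_0 = p_1 and z_2 = (p_3 − p_1^3)/3.) -/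
open MvPolynomial Matrix

noncomputable section

/-- If `y` solves the system `y i = c + ∑ j > i, x j * y j - ∑ j < i, x j * y j`, then
`∑ j, x j * y j` is related to `c` through the products `∏ (1 ± x j)`. -/
theorem sub_sum_mul_prod_one_add {K : Type*} [CommRing K] :
    ∀ {n : ℕ} (c : K) (x y : Fin n → K),
      (∀ i, y i = c + ∑ j, (if i < j then x j else if j < i then -x j else 0) * y j) →
      (c - ∑ j, x j * y j) * ∏ j, (1 + x j) = (c + ∑ j, x j * y j) * ∏ j, (1 - x j)
  | 0, c, x, y, _ => by simp
  | n + 1, c, x, y, h => by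
    have h0 : y 0 = c + ∑ j : Fin n, x j.succ * y j.succ := by
      simpa [Fin.sum_univ_succ] using h 0
    have ih := sub_sum_mul_prod_one_add (c - x 0 * y 0) (fun j => x j.succ) (fun j => y j.succ)
      (fun i => by
        have hi := h i.succ
        simp only [Fin.sum_univ_succ, Fin.succ_lt_succ_iff, Fin.not_lt_zero, Fin.succ_pos,
          if_true, if_false] at hi
        linear_combination hi)
    simp only [Fin.sum_univ_succ, Fin.prod_univ_succ] at ih ⊢
    linear_combination (1 + x 0) * ih +
      (-2 * x 0 * ∏ j : Fin n, (1 - x j.succ)) * h0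

/-- The logarithmic derivative of `∏ (1 + c j * X)`. -/
theorem derivative_prod_one_add {ι K : Type*} [CommRing K] (s : Finset ι) (c : ι → K) :
    PowerSeries.derivative K (∏ j ∈ s, (1 + PowerSeries.X * PowerSeries.C (c j))) =
      PowerSeries.mk (fun m => ∑ j ∈ s, (-1) ^ m * c j ^ (m + 1)) *
        ∏ j ∈ s, (1 + PowerSeries.X * PowerSeries.C (c j)) := by
  classical
  induction s using Finset.induction_on with
  | empty =>
    ext m
    simp
  | insert a s ha ih =>
    have hgeom : PowerSeries.mk (fun m => (-1) ^ m * c a ^ (m + 1)) *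
        (1 + PowerSeries.X * PowerSeries.C (c a)) = PowerSeries.C (c a) := by
      ext m
      rw [mul_add, mul_one, mul_comm PowerSeries.X, ← mul_assoc]
      cases m with
      | zero => simp
      | succ m =>
        simp [PowerSeries.coeff_succ_mul_X]
        ring
    have hsum : PowerSeries.mk (fun m => ∑ j ∈ insert a s, (-1) ^ m * c j ^ (m + 1)) =
        PowerSeries.mk (fun m => (-1) ^ m * c a ^ (m + 1)) +
          PowerSeries.mk (fun m => ∑ j ∈ s, (-1) ^ m * c j ^ (m + 1)) := by
      ext m
      simp [Finset.sum_insert ha]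
    have hlin : PowerSeries.derivative K (1 + PowerSeries.X * PowerSeries.C (c a)) =
        PowerSeries.C (c a) := by
      simp [Derivation.leibniz]
    rw [Finset.prod_insert ha, Derivation.leibniz, ih, hsum, hlin]
    simp only [smul_eq_mul]
    linear_combination (-∏ j ∈ s, (1 + PowerSeries.X * PowerSeries.C (c j))) * hgeom

/-- The power series `∑ ζ_m t^(m+1)`. -/
def zetaSeries (n : ℕ) : PowerSeries (MvPolynomial (Fin n) ℂ) :=
  PowerSeries.X * PowerSeries.mk (zeta n)

theorem zeta_eq_sum (n m : ℕ) :
    zeta n m = ∑ j, X j * (Tmat n ^ m).mulVec (fun _ => 1) j := by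
  simp [zeta, dotProduct, Matrix.mulVec_diagonal]

theorem zetaSeries_mul_prod (n : ℕ) :
    (1 - zetaSeries n) * ∏ j : Fin n, (1 + PowerSeries.X * PowerSeries.C (X j)) =
      (1 + zetaSeries n) * ∏ j : Fin n, (1 + PowerSeries.X * PowerSeries.C (-X j)) := by
  have hG : zetaSeries n = ∑ j : Fin n, PowerSeries.X * PowerSeries.C (X j) *
      PowerSeries.mk (fun m => (Tmat n ^ m).mulVec (fun _ => 1) j) := by
    simp only [zetaSeries, mul_assoc, ← Finset.mul_sum]
    congr 1
    ext1 m
    simp [zeta_eq_sum]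
  have key := sub_sum_mul_prod_one_add (1 : PowerSeries (MvPolynomial (Fin n) ℂ))
    (fun j => PowerSeries.X * PowerSeries.C (X j))
    (fun j => PowerSeries.mk (fun m => (Tmat n ^ m).mulVec (fun _ => 1) j))
    (fun i => by
      have hfac : ∀ j : Fin n, (if i < j then PowerSeries.X * PowerSeries.C (X j)
          else if j < i then -(PowerSeries.X * PowerSeries.C (X j)) else 0) =
          PowerSeries.X * PowerSeries.C (Tmat n i j) := by
        intro j
        simp only [Tmat, Matrix.of_apply]
        split_ifs <;> simp
      simp only [hfac, mul_assoc, ← Finset.mul_sum]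
      ext1 m
      cases m with
      | zero => simp
      | succ m =>
        rw [PowerSeries.coeff_mk, pow_succ', ← Matrix.mulVec_mulVec]
        simp [PowerSeries.coeff_succ_X_mul, PowerSeries.coeff_one, Matrix.mulVec, dotProduct])
  rw [hG]
  simpa only [map_neg, mul_neg, ← sub_eq_add_neg] using key

theorem derivative_zetaSeries (n : ℕ) :
    2 * PowerSeries.derivative _ (zetaSeries n) =
      PowerSeries.mk (fun m => (1 + (-1) ^ m) * psum (Fin n) ℂ (m + 1)) *
        (1 - zetaSeries n ^ 2) := by
  have hrel := zetaSeries_mul_prod n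
  have hA := derivative_prod_one_add Finset.univ (fun j : Fin n => (X j : MvPolynomial (Fin n) ℂ))
  have hB := derivative_prod_one_add Finset.univ (fun j : Fin n => -(X j : MvPolynomial (Fin n) ℂ))
  have hP : PowerSeries.mk (fun m => (1 + (-1) ^ m) * psum (Fin n) ℂ (m + 1)) =
      PowerSeries.mk (fun m => ∑ j : Fin n, (-1) ^ m * (X j : MvPolynomial (Fin n) ℂ) ^ (m + 1)) -
      PowerSeries.mk
        (fun m => ∑ j : Fin n, (-1) ^ m * (-(X j : MvPolynomial (Fin n) ℂ)) ^ (m + 1)) := by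
    ext1 m
    have hs : ((-1 : MvPolynomial (Fin n) ℂ) ^ m) * (-1) ^ m = 1 := by
      rw [← mul_pow]; simp
    simp only [map_sub, PowerSeries.coeff_mk, psum, ← Finset.mul_sum]
    simp only [neg_pow (X _ : MvPolynomial (Fin n) ℂ), ← Finset.mul_sum]
    rw [pow_succ (-1 : MvPolynomial (Fin n) ℂ) m]
    linear_combination (-∑ j : Fin n, (X j : MvPolynomial (Fin n) ℂ) ^ (m + 1)) * hs
  have hA0 :
      ∏ j : Fin n, (1 + PowerSeries.X * PowerSeries.C (X j : MvPolynomial (Fin n) ℂ)) ≠ 0 := by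
    intro h
    simpa using congrArg PowerSeries.constantCoeff h
  have hd := congrArg (PowerSeries.derivative _) hrel
  rw [Derivation.leibniz, Derivation.leibniz, hA, hB] at hd
  simp only [smul_eq_mul, map_sub, map_add, Derivation.map_one_eq_zero] at hd
  rw [hP]
  apply mul_right_cancel₀ hA0
  generalize PowerSeries.mk (fun m => ∑ j : Fin n, (-1) ^ m *
    (X j : MvPolynomial (Fin n) ℂ) ^ (m + 1)) = a at hd ⊢
  generalize PowerSeries.mk (fun m => ∑ j : Fin n, (-1) ^ m *
    (-(X j : MvPolynomial (Fin n) ℂ)) ^ (m + 1)) = b at hd ⊢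
  generalize ∏ j : Fin n, (1 + PowerSeries.X * PowerSeries.C (X j : MvPolynomial (Fin n) ℂ)) = A
    at hrel hd ⊢
  generalize ∏ j : Fin n, (1 + PowerSeries.X * PowerSeries.C (-X j : MvPolynomial (Fin n) ℂ)) = B
    at hrel hd ⊢
  generalize PowerSeries.derivative _ (zetaSeries n) = G' at hd ⊢
  generalize zetaSeries n = G at hrel hd ⊢
  linear_combination -(1 + G) * hd + (G' + (1 + G) * b) * hrel

theorem coeff_mul_mem {K A : Type*} [CommRing K] [CommRing A] [Algebra K A] (S : Subalgebra K A)
    {f g : PowerSeries A} {m : ℕ} (hf : ∀ i ≤ m, PowerSeries.coeff i f ∈ S)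
    (hg : ∀ i ≤ m, PowerSeries.coeff i g ∈ S) : PowerSeries.coeff m (f * g) ∈ S := by
  rw [PowerSeries.coeff_mul]
  refine S.sum_mem fun p hp => S.mul_mem (hf _ ?_) (hg _ ?_)
  · have := Finset.HasAntidiagonal.mem_antidiagonal.1 hp
    omega
  · have := Finset.HasAntidiagonal.mem_antidiagonal.1 hp
    omega

theorem coeff_zetaSeries_mem (n m : ℕ) :
    PowerSeries.coeff m (zetaSeries n) ∈
      Algebra.adjoin ℂ {p : MvPolynomial (Fin n) ℂ | ∃ m : ℕ, p = psum (Fin n) ℂ (2 * m + 1)} := by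
  set S := Algebra.adjoin ℂ
    {p : MvPolynomial (Fin n) ℂ | ∃ m : ℕ, p = psum (Fin n) ℂ (2 * m + 1)} with hS
  induction m using Nat.strong_induction_on with
  | _ m ih =>
    cases m with
    | zero => simp [zetaSeries]
    | succ m =>
      have hG : ∀ i ≤ m, PowerSeries.coeff i (zetaSeries n) ∈ S := fun i hi => ih i (by omega)
      have hmem : PowerSeries.coeff m (2 * PowerSeries.derivative _ (zetaSeries n)) ∈ S := by
        rw [derivative_zetaSeries]
        refine coeff_mul_mem S (fun i _ => ?_) (fun i hi => ?_)
        · rw [PowerSeries.coeff_mk]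
          rcases Nat.even_or_odd' i with ⟨k, rfl | rfl⟩
          · exact S.mul_mem (S.add_mem S.one_mem (S.pow_mem (S.neg_mem S.one_mem) _))
              (Algebra.subset_adjoin ⟨k, rfl⟩)
          · simp [pow_succ, pow_mul]
        · rw [map_sub, PowerSeries.coeff_one, sq]
          refine S.sub_mem ?_ (coeff_mul_mem S (fun j hj => hG j (hj.trans hi))
            fun j hj => hG j (hj.trans hi))
          split_ifs
          exacts [S.one_mem, S.zero_mem]
      have hne : (2 * ((m : ℂ) + 1)) ≠ 0 := mul_ne_zero two_ne_zero (Nat.cast_add_one_ne_zero m)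
      have heq : PowerSeries.coeff m (2 * PowerSeries.derivative _ (zetaSeries n)) =
          (2 * ((m : ℂ) + 1)) • PowerSeries.coeff (m + 1) (zetaSeries n) := by
        rw [two_mul, map_add, PowerSeries.coeff_derivative, Algebra.smul_def]
        simp only [map_mul, map_add, map_natCast, map_ofNat, map_one]
        ring
      have := S.smul_mem hmem (2 * ((m : ℂ) + 1))⁻¹
      rwa [heq, inv_smul_smul₀ hne] at this

theorem zeta_Q_symmetric (n : ℕ) (hn : 0 < n) (k : ℕ) :
    zeta n (2 * k) ∈
      Algebra.adjoin ℂ {p : MvPolynomial (Fin n) ℂ | ∃ m : ℕ, p = psum (Fin n) ℂ (2 * m + 1)} := by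
  have h := coeff_zetaSeries_mem n (2 * k + 1)
  rwa [zetaSeries, PowerSeries.coeff_succ_X_mul, PowerSeries.coeff_mk] at h
end
end

section
/- In the Clifford algebra Cl(Q), for all i, j ≥ 0 the anticommutator φ_i φ_j + φ_j φ_i equals (−1)^i · 2 · ζ_{i+j} (viewed as a scalar via the structure map R → Cl(Q)) if i + j is even, and equals 0 if i + j is odd. -/
open MvPolynomial Matrix

noncomputable section

/-- The quadratic form `Q` on the free module `R^n` (with `R = ℂ[x₁,…,xₙ]`) satisfying
`Q(eᵢ) = xᵢ` and whose polar form satisfies `B(eᵢ, eⱼ) = 0` for `i ≠ j`. -/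
def Qform (n : ℕ) : QuadraticForm (MvPolynomial (Fin n) ℂ) (Fin n → MvPolynomial (Fin n) ℂ) :=
  QuadraticMap.weightedSumSquares (MvPolynomial (Fin n) ℂ)
    (fun i : Fin n => (X i : MvPolynomial (Fin n) ℂ))

/-- The elements `φ_k = ι (T^k v)` of the Clifford algebra `Cl(Q)`. -/
def phi (n k : ℕ) : CliffordAlgebra (Qform n) :=
  CliffordAlgebra.ι (Qform n) ((Tmat n ^ k).mulVec (fun _ => 1))

/-- The matrix `C * T` is skew-symmetric, which makes `T` skew-adjoint with respect to `C`. -/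
theorem transpose_Tmat_mul_diagonal (n : ℕ) :
    (Tmat n)ᵀ * diagonal (fun k => (X k : MvPolynomial (Fin n) ℂ)) =
      -(diagonal (fun k => X k) * Tmat n) := by
  ext1 a b
  rw [mul_diagonal, neg_apply, diagonal_mul, transpose_apply]
  simp only [Tmat, of_apply]
  rcases lt_trichotomy a b with h | rfl | h
  · simp [h, h.not_gt, mul_comm]
  · simp
  · simp [h, h.not_gt]

theorem transpose_Tmat_pow_mul_diagonal (n i : ℕ) :
    (Tmat n ^ i)ᵀ * diagonal (fun k => (X k : MvPolynomial (Fin n) ℂ)) =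
      (-1 : MvPolynomial (Fin n) ℂ) ^ i • (diagonal (fun k => X k) * Tmat n ^ i) := by
  induction i with
  | zero => simp
  | succ i ih =>
    rw [pow_succ (Tmat n), transpose_mul, Matrix.mul_assoc, ih, Matrix.mul_smul,
      ← Matrix.mul_assoc, transpose_Tmat_mul_diagonal, Matrix.neg_mul, Matrix.mul_assoc,
      ← pow_succ', pow_succ (-1 : MvPolynomial (Fin n) ℂ), mul_neg_one, neg_smul, smul_neg,
      ← pow_succ]

/-- The bilinear form of `C` on the vectors `T ^ i v` and `T ^ j v`. -/
theorem dotProduct_Tmat_pow (n i j : ℕ) :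
    (Tmat n ^ i *ᵥ fun _ => 1) ⬝ᵥ
        ((diagonal fun k => (X k : MvPolynomial (Fin n) ℂ)) *ᵥ (Tmat n ^ j *ᵥ fun _ => 1)) =
      (-1) ^ i * zeta n (i + j) := by
  rw [← vecMul_transpose, ← dotProduct_mulVec, mulVec_mulVec, transpose_Tmat_pow_mul_diagonal,
    smul_mulVec, dotProduct_smul, ← mulVec_mulVec, mulVec_mulVec _ (Tmat n ^ i), ← pow_add,
    smul_eq_mul, zeta]

theorem zeta_eq_zero_of_odd {n m : ℕ} (hm : Odd m) : zeta n m = 0 := by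
  have h : zeta n m = -zeta n m := by
    calc zeta n m = (fun _ => 1) ⬝ᵥ ((diagonal fun k => (X k : MvPolynomial (Fin n) ℂ)) *ᵥ
          (Tmat n ^ m *ᵥ fun _ => 1)) := rfl
      _ = (Tmat n ^ m *ᵥ fun _ => 1) ⬝ᵥ ((diagonal fun k => (X k : MvPolynomial (Fin n) ℂ)) *ᵥ
          (Tmat n ^ 0 *ᵥ fun _ => 1)) := by
        simp [dotProduct, mulVec_diagonal, mul_comm]
      _ = -zeta n m := by rw [dotProduct_Tmat_pow, hm.neg_one_pow, neg_one_mul, add_zero]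
  exact self_eq_neg.mp h

theorem polar_Qform {n : ℕ} (u w : Fin n → MvPolynomial (Fin n) ℂ) :
    QuadraticMap.polar (Qform n) u w = 2 * u ⬝ᵥ ((diagonal fun k => X k) *ᵥ w) := by
  simp only [QuadraticMap.polar, Qform, QuadraticMap.weightedSumSquares_apply, dotProduct,
    mulVec_diagonal, Finset.mul_sum, ← Finset.sum_sub_distrib, Pi.add_apply, smul_eq_mul]
  exact Finset.sum_congr rfl fun k _ => by ring

theorem phi_anticommutator (n : ℕ) (hn : 0 < n) (i j : ℕ) :
    phi n i * phi n j + phi n j * phi n i =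
      if Even (i + j) then
        algebraMap (MvPolynomial (Fin n) ℂ) (CliffordAlgebra (Qform n))
          ((-1 : MvPolynomial (Fin n) ℂ) ^ i * (2 * zeta n (i + j)))
      else 0 := by
  rw [phi, phi, CliffordAlgebra.ι_mul_ι_add_swap, polar_Qform, dotProduct_Tmat_pow]
  split_ifs with h
  · rw [mul_left_comm]
  · rw [zeta_eq_zero_of_odd (Nat.not_even_iff_odd.mp h), mul_zero, mul_zero, map_zero]
end
end
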